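/- Let 0 < h₁ < h₂ ≤ 1 and let σ be a behavior strategy in the POMDP with stage duration h₁, G_{h₁}. Then there exists a behavior strategy σ̂ in G_{h₂} such that R(σ, h₁) = R(σ̂, h₂). -/

import Mathlib

open Filter

/-- A POMDP (data only): deterministic signal map `f`, stage payoff `g`,
transition kernel `P`, and initial distribution `p1`. -/
structure POMDP (Ω A S : Type*) where
  f : Ω → S
  g : Ω → A → ℝ
  P : Ω → A → Ω → ℝ
  p1 : Ω → ℝ

/-- A history `(s₁, a₁, …, a_{t-1}, s_t)`, encoded as the reversed list of past
(signal, action) pairs together with the current signal. -/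
abbrev Hist (S A : Type*) := List (S × A) × S

/-- A behavior strategy (data only): a mixed action for every finite history. -/
abbrev Strategy (S A : Type*) := Hist S A → A → ℝ

/-- `σ η ∈ Δ(A)` for every history `η`. -/
def IsStrategy {S A : Type*} [Fintype A] (σ : Strategy S A) : Prop :=
  (∀ η a, 0 ≤ σ η a) ∧ ∀ η, ∑ a, σ η a = 1

namespace POMDP

variable {Ω A S : Type*} [Fintype Ω] [Fintype A]

/-- `P ω a ∈ Δ(Ω)` for every `(ω, a)`, and `p1 ∈ Δ(Ω)`. -/
def IsValid (M : POMDP Ω A S) : Prop :=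
  (∀ ω a ω', 0 ≤ M.P ω a ω') ∧ (∀ ω a, ∑ ω', M.P ω a ω' = 1) ∧
    (∀ ω, 0 ≤ M.p1 ω) ∧ ∑ ω, M.p1 ω = 1

/-- The observable history determined by a reversed past trajectory and the
current state. -/
def obs (M : POMDP Ω A S) (rev : List (Ω × A)) (ω : Ω) : Hist S A :=
  (rev.map fun p => (M.f p.1, p.2), M.f ω)

/-- Probability of a finite trajectory `(ω₁, a₁, …, ω_t, a_t)` under a strategy,
the trajectory being given in reverse order (the head of the list is the most
recent (state, action) pair). -/
def trajP (M : POMDP Ω A S) (σ : Strategy S A) : List (Ω × A) → ℝ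
  | [] => 1
  | (ω, a) :: rest =>
      (match rest with
        | [] => M.p1 ω
        | (ω', a') :: _ => M.P ω' a' ω) *
        σ (M.obs rest ω) a * trajP M σ rest

/-- The expected stage-`(n+1)` payoff `E_σ[g(ω_{n+1}, a_{n+1})]`. -/
noncomputable def stageE (M : POMDP Ω A S) (σ : Strategy S A) (n : ℕ) : ℝ :=
  ∑ tr : Fin (n + 1) → Ω × A, trajP M σ (List.ofFn tr) * M.g (tr 0).1 (tr 0).2

/-- The expected long-run average payoff
`R(σ) = liminf_T E_σ[(1/T) ∑_{i=1}^T g(ω_i, a_i)]`. -/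
noncomputable def R (M : POMDP Ω A S) (σ : Strategy S A) : ℝ :=
  liminf (fun T : ℕ => (1 / (T : ℝ)) * ∑ n ∈ Finset.range T, stageE M σ n) atTop

/-- The POMDP `G_h` with stage duration `h`:
`P_h(⬝|ω,a) = h·P(⬝|ω,a) + (1-h)·δ_ω`. -/
def dur [DecidableEq Ω] (M : POMDP Ω A S) (h : ℝ) : POMDP Ω A S :=
  { M with P := fun ω a ω' => h * M.P ω a ω' + (1 - h) * (if ω' = ω then 1 else 0) }

/-- The asymptotic value `V(h) = sup_σ R(σ, h)` of `G_h`. -/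
noncomputable def V [DecidableEq Ω] (M : POMDP Ω A S) (h : ℝ) : ℝ :=
  sSup {r | ∃ σ : Strategy S A, IsStrategy σ ∧ r = (M.dur h).R σ}

end POMDP

/-- The solution of `x (n + 1) = (1 - q) * x n + q * y n` with nonnegative summable input `y` is
summable. -/
theorem hasSum_of_geometric_recursion {q : ℝ} (hq0 : 0 < q) {x y : ℕ → ℝ} {Y : ℝ}
    (hx : ∀ n, 0 ≤ x n) (hy : ∀ n, 0 ≤ y n) (hY : HasSum y Y)
    (hrec : ∀ n, x (n + 1) = (1 - q) * x n + q * y n) : HasSum x (x 0 / q + Y) := by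
  have hpart : ∀ N, ∑ n ∈ Finset.range N, x n ≤ x 0 / q + Y := by
    intro N
    have h1 : ∑ n ∈ Finset.range (N + 1), x n
        = (1 - q) * ∑ n ∈ Finset.range N, x n + q * ∑ n ∈ Finset.range N, y n + x 0 := by
      rw [Finset.sum_range_succ', Finset.mul_sum, Finset.mul_sum, ← Finset.sum_add_distrib]
      simp only [hrec]
    rw [Finset.sum_range_succ] at h1
    have h2 : ∑ n ∈ Finset.range N, y n ≤ Y := sum_le_hasSum _ (fun i _ => hy i) hY
    have h3 := hx N
    have h4 : q * ∑ n ∈ Finset.range N, x n ≤ q * (x 0 / q + Y) := by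
      have : q * (x 0 / q + Y) = x 0 + q * Y := by field_simp
      nlinarith
    exact le_of_mul_le_mul_left h4 hq0
  have hs : Summable x := summable_of_sum_range_le hx hpart
  have h1 := hs.tsum_eq_zero_add
  have h2 : HasSum (fun n => x (n + 1)) ((1 - q) * ∑' n, x n + q * Y) := by
    simp only [hrec]
    exact (hs.hasSum.mul_left _).add (hY.mul_left _)
  rw [h2.tsum_eq] at h1
  have h3 : ∑' n, x n = x 0 / q + Y := by
    field_simp
    linarith
  exact h3 ▸ hs.hasSum

/-- The binomial probability of `k` successes in `n` trials, defined by Pascal's rule. -/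
def binomWeight (q : ℝ) : ℕ → ℕ → ℝ
  | 0, 0 => 1
  | 0, _ + 1 => 0
  | n + 1, 0 => (1 - q) * binomWeight q n 0
  | n + 1, k + 1 => (1 - q) * binomWeight q n (k + 1) + q * binomWeight q n k

theorem binomWeight_nonneg {q : ℝ} (hq0 : 0 < q) (hq1 : q < 1) :
    ∀ n k, 0 ≤ binomWeight q n k := by
  have : 0 < 1 - q := by linarith
  intro n
  induction n with
  | zero => intro k; cases k <;> simp [binomWeight]
  | succ n ih =>
    intro k
    have h0 := ih 0
    cases k with
    | zero => simp only [binomWeight]; positivity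
    | succ k =>
      have h1 := ih (k + 1)
      have h2 := ih k
      simp only [binomWeight]; positivity

theorem binomWeight_eq_zero (q : ℝ) : ∀ n k, n < k → binomWeight q n k = 0 := by
  intro n
  induction n with
  | zero => intro k hk; cases k <;> simp_all [binomWeight]
  | succ n ih =>
    intro k hk
    cases k with
    | zero => omega
    | succ k => simp [binomWeight, ih (k + 1) (by omega), ih k (by omega)]

theorem hasSum_binomWeight {q : ℝ} (hq0 : 0 < q) (hq1 : q < 1) (k : ℕ) :
    HasSum (fun n => binomWeight q n k) (1 / q) := by
  induction k with
  | zero =>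
    simpa [binomWeight] using hasSum_of_geometric_recursion (Y := 0) (y := fun _ => 0) hq0
      (fun n => binomWeight_nonneg hq0 hq1 n 0) (fun _ => le_rfl) hasSum_zero
      (fun n => by simp [binomWeight])
  | succ k ih =>
    simpa [binomWeight] using hasSum_of_geometric_recursion hq0
      (fun n => binomWeight_nonneg hq0 hq1 n (k + 1))
      (fun n => binomWeight_nonneg hq0 hq1 n k) ih (fun n => by simp [binomWeight])

/-- Expectation under the binomial distribution. -/
def binomE (q : ℝ) (n : ℕ) (φ : ℕ → ℝ) : ℝ :=
  ∑ k ∈ Finset.range (n + 1), binomWeight q n k * φ k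

theorem binomE_zero (q : ℝ) (φ : ℕ → ℝ) : binomE q 0 φ = φ 0 := by
  simp [binomE, binomWeight]

theorem binomE_succ (q : ℝ) (n : ℕ) (φ : ℕ → ℝ) :
    binomE q (n + 1) φ = binomE q n (fun k => (1 - q) * φ k + q * φ (k + 1)) := by
  have h := Finset.sum_range_succ' (fun k => binomWeight q n k * φ k) (n + 1)
  rw [Finset.sum_range_succ, binomWeight_eq_zero q n (n + 1) (by omega)] at h
  simp only [binomE]
  rw [Finset.sum_range_succ']
  simp only [binomWeight, add_mul, mul_add, Finset.sum_add_distrib]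
  have h1 : ∑ k ∈ Finset.range (n + 1), binomWeight q n k * ((1 - q) * φ k)
      = (1 - q) * ∑ k ∈ Finset.range (n + 1), binomWeight q n k * φ k := by
    rw [Finset.mul_sum]; exact Finset.sum_congr rfl fun _ _ => by ring
  have h2 : ∑ k ∈ Finset.range (n + 1), (1 - q) * binomWeight q n (k + 1) * φ (k + 1)
      = (1 - q) * ∑ k ∈ Finset.range (n + 1), binomWeight q n (k + 1) * φ (k + 1) := by
    rw [Finset.mul_sum]; exact Finset.sum_congr rfl fun _ _ => by ring
  have h3 : ∑ k ∈ Finset.range (n + 1), q * binomWeight q n k * φ (k + 1)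
      = ∑ k ∈ Finset.range (n + 1), binomWeight q n k * (q * φ (k + 1)) :=
    Finset.sum_congr rfl fun _ _ => by ring
  rw [h1, h2, h3]
  linear_combination (-(1 - q)) * h

theorem binomE_add (q : ℝ) (n : ℕ) (φ ψ : ℕ → ℝ) :
    binomE q n (fun k => φ k + ψ k) = binomE q n φ + binomE q n ψ := by
  simp [binomE, mul_add, Finset.sum_add_distrib]

theorem binomE_mul_left (q : ℝ) (n : ℕ) (r : ℝ) (φ : ℕ → ℝ) :
    binomE q n (fun k => r * φ k) = r * binomE q n φ := by
  simp only [binomE, Finset.mul_sum]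
  exact Finset.sum_congr rfl fun _ _ => by ring

theorem binomE_const (q : ℝ) (n : ℕ) (r : ℝ) : binomE q n (fun _ => r) = r := by
  induction n with
  | zero => exact binomE_zero q _
  | succ n ih => rw [binomE_succ]; convert ih using 3; ring

theorem binomE_mono {q : ℝ} (hq0 : 0 < q) (hq1 : q < 1) (n : ℕ) {φ ψ : ℕ → ℝ}
    (h : ∀ k, φ k ≤ ψ k) : binomE q n φ ≤ binomE q n ψ :=
  Finset.sum_le_sum fun k _ => mul_le_mul_of_nonneg_left (h k) (binomWeight_nonneg hq0 hq1 n k)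

theorem binomE_variance (q : ℝ) (n : ℕ) :
    binomE q n (fun k => ((k : ℝ) - n * q) ^ 2) = n * (q * (1 - q)) := by
  induction n with
  | zero => simp [binomE_zero]
  | succ n ih =>
    have : (fun k : ℕ => (1 - q) * ((k : ℝ) - (n + 1 : ℕ) * q) ^ 2
        + q * (((k + 1 : ℕ) : ℝ) - (n + 1 : ℕ) * q) ^ 2)
        = fun k : ℕ => ((k : ℝ) - n * q) ^ 2 + q * (1 - q) := by
      funext k; push_cast; ring
    rw [binomE_succ, this, binomE_add, ih, binomE_const]
    push_cast; ring

/-- Wald's identity for the number of successes after the first `m`. -/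
theorem sum_binomE_indicator (q : ℝ) (m T : ℕ) :
    q * ∑ n ∈ Finset.range T, binomE q n (fun k => if m ≤ k then 1 else 0)
      = binomE q T (fun k => ((k - m : ℕ) : ℝ)) := by
  induction T with
  | zero => simp [binomE_zero]
  | succ T ih =>
    rw [Finset.sum_range_succ, mul_add, ih, binomE_succ, ← binomE_mul_left, ← binomE_add]
    congr 1
    funext k
    split_ifs with h
    · rw [Nat.cast_sub h, Nat.cast_sub (by omega)]; push_cast; ring
    · simp [Nat.sub_eq_zero_of_le (show k ≤ m by omega),
        Nat.sub_eq_zero_of_le (show k + 1 ≤ m by omega)]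

theorem binomE_sub_floor_le {q : ℝ} (hq0 : 0 < q) (hq1 : q < 1) (T : ℕ) :
    binomE q T (fun k => ((k - ⌊q * T⌋₊ : ℕ) : ℝ)) ≤ √T + 1 := by
  rcases Nat.eq_zero_or_pos T with rfl | hT
  · simp [binomE_zero]
  have hs : 0 < √(T : ℝ) := Real.sqrt_pos.2 (by exact_mod_cast hT)
  have hss : √(T : ℝ) * √T = T := Real.mul_self_sqrt (Nat.cast_nonneg T)
  have hle : ∀ k : ℕ, ((k - ⌊q * T⌋₊ : ℕ) : ℝ)
      ≤ 1 / (2 * √T) * ((k : ℝ) - T * q) ^ 2 + (√T / 2 + 1) := by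
    intro k
    have hfl := Nat.lt_floor_add_one (q * T)
    have h1 : (k : ℝ) - T * q ≤ 1 / (2 * √T) * ((k : ℝ) - T * q) ^ 2 + √T / 2 := by
      rw [← sub_nonneg]
      have : 1 / (2 * √T) * ((k : ℝ) - T * q) ^ 2 + √T / 2 - ((k : ℝ) - T * q)
          = 1 / (2 * √T) * (((k : ℝ) - T * q) - √T) ^ 2 := by
        field_simp; ring
      rw [this]; positivity
    rcases le_total ⌊q * T⌋₊ k with h | h
    · rw [Nat.cast_sub h]; linarith
    · rw [Nat.sub_eq_zero_of_le h, Nat.cast_zero]; positivity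
  refine (binomE_mono hq0 hq1 T hle).trans ?_
  rw [binomE_add, binomE_mul_left, binomE_variance, binomE_const]
  have : 1 / (2 * √(T : ℝ)) * (T * (q * (1 - q))) = √T / 2 * (q * (1 - q)) := by
    field_simp; rw [Real.sq_sqrt (Nat.cast_nonneg T)]
  rw [this]
  have : q * (1 - q) ≤ 1 := by nlinarith
  nlinarith

theorem abs_sum_sub_sum_div_le {q C : ℝ} (hq0 : 0 < q) (hq1 : q < 1) {X : ℕ → ℕ → ℝ}
    {u v : ℕ → ℝ} (hX : ∀ n k, |X n k| ≤ C * binomWeight q n k)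
    (hu : ∀ n, u n = ∑ k ∈ Finset.range (n + 1), X n k)
    (hv : ∀ k, HasSum (fun n => q * X n k) (v k)) (T : ℕ) :
    |∑ n ∈ Finset.range T, u n - (∑ k ∈ Finset.range ⌊q * T⌋₊, v k) / q|
      ≤ 2 * C * (√T + 1) / q := by
  set m := ⌊q * (T : ℝ)⌋₊ with hm
  have hC : 0 ≤ C := by simpa [binomWeight] using (abs_nonneg _).trans (hX 0 0)
  have hmq : (m : ℝ) ≤ q * T := Nat.floor_le (by positivity)
  have hmT : m ≤ T := by
    have : (m : ℝ) ≤ T := hmq.trans (by nlinarith [Nat.cast_nonneg (α := ℝ) T])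
    exact_mod_cast this
  have hX0 : ∀ n k, n < k → X n k = 0 := fun n k h => by
    simpa [binomWeight_eq_zero q n k h] using hX n k
  have hsplit : ∀ Y : ℕ → ℕ → ℝ, (∀ n k, n < k → Y n k = 0) → ∀ n ∈ Finset.range T,
      ∑ k ∈ Finset.range (n + 1), Y n k
        = ∑ k ∈ Finset.range m, Y n k + ∑ k ∈ Finset.Ico m T, Y n k := by
    intro Y hY n hn
    rw [Finset.sum_range_add_sum_Ico _ hmT]
    refine Finset.sum_subset (Finset.range_subset_range.2 (by simpa using hn)) ?_
    intro k _ hk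
    exact hY n k (by simpa using hk)
  set G := ∑ n ∈ Finset.range T, ∑ k ∈ Finset.Ico m T, binomWeight q n k with hG
  have hGle : q * G ≤ √T + 1 := by
    refine le_trans (le_of_eq ?_) (binomE_sub_floor_le hq0 hq1 T)
    rw [← sum_binomE_indicator, hG]
    congr 1
    refine Finset.sum_congr rfl fun n hn => ?_
    have := hsplit (fun n k => binomWeight q n k * if m ≤ k then 1 else 0)
      (fun n k h => by simp [binomWeight_eq_zero q n k h]) n hn
    rw [binomE, this, Finset.sum_eq_zero (s := Finset.range m), zero_add]
    · exact Finset.sum_congr rfl fun k hk => by simp [(Finset.mem_Ico.1 hk).1]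
    · intro k hk; simp [Finset.mem_range.1 hk]
  have hmass : ∑ n ∈ Finset.range T, ∑ k ∈ Finset.range m, binomWeight q n k + G = T := by
    rw [hG, ← Finset.sum_add_distrib,
      Finset.sum_congr rfl fun n hn => (hsplit _ (binomWeight_eq_zero q) n hn).symm]
    have : ∀ n, ∑ k ∈ Finset.range (n + 1), binomWeight q n k = 1 := fun n => by
      simpa [binomE] using binomE_const q n 1
    simp [this]
  have htail : ∀ k, |v k / q - ∑ n ∈ Finset.range T, X n k|
      ≤ C * (1 / q - ∑ n ∈ Finset.range T, binomWeight q n k) := by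
    intro k
    have h1 : HasSum (fun n => X n k) (v k / q) := by
      have := (hv k).div_const q
      simpa [mul_div_cancel_left₀ _ hq0.ne'] using this
    have h2 := (hasSum_nat_add_iff' T).2 h1
    have h3 := ((hasSum_nat_add_iff' T).2 (hasSum_binomWeight hq0 hq1 k)).mul_left C
    refine abs_le.2 ⟨?_, ?_⟩
    · exact hasSum_le (fun n => (abs_le.1 (hX (n + T) k)).1) h3.neg h2
    · exact hasSum_le (fun n => (abs_le.1 (hX (n + T) k)).2) h2 h3
  have hdec : ∑ n ∈ Finset.range T, u n - (∑ k ∈ Finset.range m, v k) / q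
      = ∑ n ∈ Finset.range T, ∑ k ∈ Finset.Ico m T, X n k
        - ∑ k ∈ Finset.range m, (v k / q - ∑ n ∈ Finset.range T, X n k) := by
    rw [Finset.sum_congr rfl fun n hn => (hu n).trans (hsplit X hX0 n hn),
      Finset.sum_add_distrib, Finset.sum_sub_distrib, Finset.sum_comm, Finset.sum_div]
    ring
  have hb1 : |∑ n ∈ Finset.range T, ∑ k ∈ Finset.Ico m T, X n k| ≤ C * G := by
    rw [hG, Finset.mul_sum]
    refine (Finset.abs_sum_le_sum_abs _ _).trans (Finset.sum_le_sum fun n _ => ?_)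
    rw [Finset.mul_sum]
    exact (Finset.abs_sum_le_sum_abs _ _).trans (Finset.sum_le_sum fun k _ => hX n k)
  have hb2 : |∑ k ∈ Finset.range m, (v k / q - ∑ n ∈ Finset.range T, X n k)| ≤ C * G := by
    refine (Finset.abs_sum_le_sum_abs _ _).trans
      ((Finset.sum_le_sum fun k _ => htail k).trans ?_)
    rw [← Finset.mul_sum]
    refine mul_le_mul_of_nonneg_left ?_ hC
    rw [Finset.sum_sub_distrib, Finset.sum_comm]
    have : (m : ℝ) / q ≤ T := by rw [div_le_iff₀ hq0]; linarith
    simp only [Finset.sum_const, Finset.card_range, nsmul_eq_mul, mul_one_div]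
    linarith
  rw [hdec]
  refine (abs_sub _ _).trans ((add_le_add hb1 hb2).trans ?_)
  rw [le_div_iff₀ hq0]
  nlinarith

theorem liminf_eq_of_tendsto_sub {ι : Type*} {l : Filter ι} [l.NeBot] {u v : ι → ℝ} {C : ℝ}
    (hv : ∀ i, |v i| ≤ C) (h : Tendsto (fun i => u i - v i) l (nhds 0)) :
    liminf u l = liminf v l := by
  have hvb : IsBoundedUnder (· ≥ ·) l v := isBoundedUnder_of ⟨-C, fun i => (abs_le.1 (hv i)).1⟩
  have hva : IsBoundedUnder (· ≤ ·) l v := isBoundedUnder_of ⟨C, fun i => (abs_le.1 (hv i)).2⟩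
  have hu : u = (fun i => u i - v i) + v := by funext i; simp
  refine le_antisymm ?_ ?_
  · have := liminf_add_le h.isBoundedUnder_ge h.isBoundedUnder_le hvb hva.isCoboundedUnder_ge
    rwa [← hu, h.limsup_eq, zero_add] at this
  · have := le_liminf_add h.isBoundedUnder_ge h.isBoundedUnder_le hvb hva.isCoboundedUnder_ge
    rwa [← hu, h.liminf_eq, zero_add] at this

theorem map_floor_mul_atTop {q : ℝ} (hq0 : 0 < q) (hq1 : q < 1) :
    map (fun T : ℕ => ⌊q * T⌋₊) atTop = atTop := by
  refine map_atTop_eq_of_gc (fun m => ⌈((m : ℝ) + 1) / q⌉₊ - 1) 0 ?_ ?_ ?_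
  · intro a b hab
    exact Nat.floor_le_floor (by gcongr)
  · intro a c _
    have hpos : 0 < ⌈((c : ℝ) + 1) / q⌉₊ := Nat.ceil_pos.2 (by positivity)
    rw [← Nat.lt_succ_iff, Nat.floor_lt (by positivity), Nat.le_sub_one_iff_lt hpos, Nat.lt_ceil,
      lt_div_iff₀ hq0]
    push_cast
    rw [mul_comm]
  · intro c _
    refine Nat.le_floor ?_
    have h1 := Nat.le_ceil (((c : ℝ) + 1) / q)
    have hpos : 0 < ⌈((c : ℝ) + 1) / q⌉₊ := Nat.ceil_pos.2 (by positivity)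
    rw [div_le_iff₀ hq0] at h1
    rw [Nat.cast_sub (by omega)]
    push_cast
    linarith

/-- A random time change by binomial counts does not affect the lower Cesàro average. -/
theorem liminf_average_eq_of_binomWeight {q C : ℝ} (hq0 : 0 < q) (hq1 : q < 1)
    {X : ℕ → ℕ → ℝ} {u v : ℕ → ℝ} (hX : ∀ n k, |X n k| ≤ C * binomWeight q n k)
    (hu : ∀ n, u n = ∑ k ∈ Finset.range (n + 1), X n k)
    (hv : ∀ k, HasSum (fun n => q * X n k) (v k)) :
    liminf (fun T : ℕ => (1 / (T : ℝ)) * ∑ n ∈ Finset.range T, u n) atTop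
      = liminf (fun T : ℕ => (1 / (T : ℝ)) * ∑ n ∈ Finset.range T, v n) atTop := by
  have hC : 0 ≤ C := by simpa [binomWeight] using (abs_nonneg _).trans (hX 0 0)
  have hvC : ∀ k, |v k| ≤ C := by
    intro k
    have h := ((hasSum_binomWeight hq0 hq1 k).mul_left C).mul_left q
    have hs : q * (C * (1 / q)) = C := by field_simp
    rw [hs] at h
    refine abs_le.2 ⟨hasSum_le (fun n => ?_) h.neg (hv k), hasSum_le (fun n => ?_) (hv k) h⟩
    · rw [← mul_neg]
      exact mul_le_mul_of_nonneg_left (abs_le.1 (hX n k)).1 hq0.le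
    · exact mul_le_mul_of_nonneg_left (abs_le.1 (hX n k)).2 hq0.le
  set A : ℕ → ℝ := fun T => (1 / (T : ℝ)) * ∑ n ∈ Finset.range T, v n with hA
  have hsum : ∀ T, ∑ n ∈ Finset.range T, v n = T * A T := by
    intro T
    rcases Nat.eq_zero_or_pos T with rfl | hT
    · simp
    · have : (T : ℝ) ≠ 0 := by positivity
      simp only [hA]; field_simp
  have hAC : ∀ T, |A T| ≤ C := by
    intro T
    rcases Nat.eq_zero_or_pos T with rfl | hT
    · simpa [hA] using hC
    · have hT' : (0 : ℝ) < T := by exact_mod_cast hT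
      have h1 : |∑ n ∈ Finset.range T, v n| ≤ T * C := by
        refine (Finset.abs_sum_le_sum_abs _ _).trans
          ((Finset.sum_le_sum fun n _ => hvC n).trans ?_)
        simp
      rw [hsum, abs_mul, abs_of_pos hT'] at h1
      exact le_of_mul_le_mul_left h1 hT'
  have hcomp : liminf A atTop = liminf (fun T : ℕ => A ⌊q * T⌋₊) atTop := by
    conv_lhs => rw [← map_floor_mul_atTop hq0 hq1]
    rfl
  rw [hcomp]
  refine liminf_eq_of_tendsto_sub (fun T => hAC _) ?_
  have hbound : ∀ T : ℕ, 0 < T → |(1 / (T : ℝ)) * ∑ n ∈ Finset.range T, u n - A ⌊q * T⌋₊|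
      ≤ 2 * C / q * (1 / √T) + 3 * C / q * (1 / T) := by
    intro T hT
    have hT' : (0 : ℝ) < T := by exact_mod_cast hT
    have h1 := abs_sum_sub_sum_div_le hq0 hq1 hX hu hv T
    have hfl := Nat.lt_floor_add_one (q * (T : ℝ))
    have hfl' : (⌊q * (T : ℝ)⌋₊ : ℝ) ≤ q * T := Nat.floor_le (by positivity)
    rw [hsum] at h1
    set m := ⌊q * (T : ℝ)⌋₊
    have h2 : (1 / (T : ℝ)) * ∑ n ∈ Finset.range T, u n - A m
        = (1 / T) * ((∑ n ∈ Finset.range T, u n - m * A m / q)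
          + ((m - q * T) / q) * A m) := by
      field_simp; ring
    have h3 : |(m - q * T) / q * A m| ≤ 1 / q * C := by
      rw [abs_mul, abs_div, abs_of_pos hq0]
      gcongr
      · exact abs_le.2 ⟨by linarith, by linarith⟩
      · exact hAC m
    rw [h2, abs_mul, abs_of_pos (by positivity : 0 < 1 / (T : ℝ))]
    have h4 : 2 * C / q * (1 / √(T : ℝ)) + 3 * C / q * (1 / T)
        = 1 / T * (2 * C * (√T + 1) / q + 1 / q * C) := by
      have hs : (0 : ℝ) < √T := Real.sqrt_pos.2 hT'
      have : 1 / √(T : ℝ) = √T / T := by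
        rw [div_eq_div_iff hs.ne' hT'.ne', one_mul, Real.mul_self_sqrt hT'.le]
      rw [this]; field_simp; ring
    rw [h4]
    gcongr
    exact (abs_add_le _ _).trans (add_le_add h1 h3)
  have hlim : Tendsto (fun T : ℕ => 2 * C / q * (1 / √(T : ℝ)) + 3 * C / q * (1 / (T : ℝ)))
      atTop (nhds 0) := by
    have h1 : Tendsto (fun T : ℕ => 1 / √(T : ℝ)) atTop (nhds 0) := by
      simp only [one_div]
      exact (Real.tendsto_sqrt_atTop.comp tendsto_natCast_atTop_atTop).inv_tendsto_atTop
    simpa using (h1.const_mul (2 * C / q)).add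
      (tendsto_one_div_atTop_nhds_zero_nat.const_mul (3 * C / q))
  refine squeeze_zero_norm' ?_ hlim
  filter_upwards [eventually_gt_atTop 0] with T hT
  exact hbound T hT

theorem sum_fin_succ_eq_sum_cons {α : Type*} [Fintype α] (n : ℕ) (F : (Fin (n + 1) → α) → ℝ) :
    ∑ tr, F tr = ∑ x, ∑ tr : Fin n → α, F (Fin.cons x tr) := by
  rw [← (Fin.consEquiv fun _ => α).sum_comp, Fintype.sum_prod_type]
  rfl

theorem abs_sum_mul_le {ι : Type*} [Fintype ι] {p x : ι → ℝ} {C : ℝ} (hp : ∀ i, 0 ≤ p i)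
    (hp1 : ∑ i, p i = 1) (hx : ∀ i, |x i| ≤ C) : |∑ i, p i * x i| ≤ C :=
  calc |∑ i, p i * x i| ≤ ∑ i, |p i * x i| := Finset.abs_sum_le_sum_abs _ _
    _ ≤ ∑ i, p i * C := Finset.sum_le_sum fun i _ => by
        rw [abs_mul, abs_of_nonneg (hp i)]
        exact mul_le_mul_of_nonneg_left (hx i) (hp i)
    _ = C := by rw [← Finset.sum_mul, hp1, one_mul]

namespace POMDP

variable {Ω A S : Type*}

/-- The law of the current state given the reversed past trajectory. -/
def stateLaw (M : POMDP Ω A S) : List (Ω × A) → Ω → ℝ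
  | [] => M.p1
  | (ω, a) :: _ => M.P ω a

theorem trajP_cons (M : POMDP Ω A S) (τ : Strategy S A) (x : Ω × A) (r : List (Ω × A)) :
    M.trajP τ (x :: r) = M.stateLaw r x.1 * τ (M.obs r x.1) x.2 * M.trajP τ r := by
  rcases x with ⟨ω, a⟩
  cases r <;> rfl

theorem dur_dur (M : POMDP Ω A S) [DecidableEq Ω] (q h : ℝ) : (M.dur h).dur q = M.dur (q * h) := by
  simp only [dur]
  congr 1
  funext ω a ω'
  ring

theorem IsValid.dur [Fintype Ω] [DecidableEq Ω] {M : POMDP Ω A S} (hM : M.IsValid) {h : ℝ}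
    (h0 : 0 ≤ h) (h1 : h ≤ 1) : (M.dur h).IsValid := by
  refine ⟨fun ω a ω' => ?_, fun ω a => ?_, hM.2.2⟩
  · have hP := hM.1 ω a ω'
    have h1' : 0 ≤ 1 - h := by linarith
    simp only [POMDP.dur]
    positivity
  · simp [POMDP.dur, Finset.sum_add_distrib, ← Finset.mul_sum, hM.2.1]

variable [Fintype Ω] [Fintype A]

/-- The expectation of a function of the observed past and the current state after `n` steps. -/
def expect (M : POMDP Ω A S) (τ : Strategy S A) : ℕ → (List (S × A) → Ω → ℝ) → ℝ
  | 0, ψ => ∑ ω, M.p1 ω * ψ [] ω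
  | n + 1, ψ => expect M τ n fun l ω =>
      ∑ a, τ (l, M.f ω) a * ∑ ω', M.P ω a ω' * ψ ((M.f ω, a) :: l) ω'

theorem expect_eq_sum_trajP (M : POMDP Ω A S) (τ : Strategy S A) (n : ℕ)
    (ψ : List (S × A) → Ω → ℝ) :
    M.expect τ n ψ = ∑ tr : Fin n → Ω × A, ∑ ω, M.stateLaw (List.ofFn tr) ω *
      M.trajP τ (List.ofFn tr) * ψ (M.obs (List.ofFn tr) ω).1 ω := by
  induction n generalizing ψ with
  | zero => simp [expect, stateLaw, trajP, obs]
  | succ n ih =>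
    rw [expect, ih]
    conv_rhs => rw [sum_fin_succ_eq_sum_cons, Finset.sum_comm]
    refine Finset.sum_congr rfl fun tr _ => ?_
    rw [Fintype.sum_prod_type]
    refine Finset.sum_congr rfl fun ω _ => ?_
    rw [Finset.mul_sum]
    refine Finset.sum_congr rfl fun a _ => ?_
    rw [Finset.mul_sum, Finset.mul_sum]
    refine Finset.sum_congr rfl fun ω' _ => ?_
    simp only [List.ofFn_cons, trajP_cons]
    simp only [stateLaw, obs, List.map_cons]
    ring

theorem stageE_eq_expect (M : POMDP Ω A S) (τ : Strategy S A) (n : ℕ) :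
    M.stageE τ n = M.expect τ n fun l ω => ∑ a, τ (l, M.f ω) a * M.g ω a := by
  rw [expect_eq_sum_trajP, stageE, sum_fin_succ_eq_sum_cons, Finset.sum_comm]
  refine Finset.sum_congr rfl fun tr _ => ?_
  rw [Fintype.sum_prod_type]
  refine Finset.sum_congr rfl fun ω _ => ?_
  rw [Finset.mul_sum]
  refine Finset.sum_congr rfl fun a _ => ?_
  simp only [List.ofFn_cons, trajP_cons, Fin.cons_zero]
  simp only [obs]
  ring

theorem expect_add (M : POMDP Ω A S) (τ : Strategy S A) (n : ℕ) (φ ψ : List (S × A) → Ω → ℝ) :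
    M.expect τ n (fun l ω => φ l ω + ψ l ω) = M.expect τ n φ + M.expect τ n ψ := by
  simp only [expect_eq_sum_trajP, mul_add, Finset.sum_add_distrib]

theorem expect_mul_left (M : POMDP Ω A S) (τ : Strategy S A) (n : ℕ) (r : ℝ)
    (ψ : List (S × A) → Ω → ℝ) :
    M.expect τ n (fun l ω => r * ψ l ω) = r * M.expect τ n ψ := by
  simp only [expect_eq_sum_trajP, Finset.mul_sum]
  exact Finset.sum_congr rfl fun _ _ => Finset.sum_congr rfl fun _ _ => by ring

theorem hasSum_expect (M : POMDP Ω A S) (τ : Strategy S A) (k : ℕ)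
    {Ψ : ℕ → List (S × A) → Ω → ℝ} {φ : List (S × A) → Ω → ℝ}
    (h : ∀ l ω, HasSum (fun n => Ψ n l ω) (φ l ω)) :
    HasSum (fun n => M.expect τ k (Ψ n)) (M.expect τ k φ) := by
  simp only [expect_eq_sum_trajP]
  exact hasSum_sum fun tr _ => hasSum_sum fun ω _ => (h _ ω).mul_left _

/-- The product of the probabilities with which a strategy selects the actions of a past. -/
def actionWeight (τ : Strategy S A) : List (S × A) → ℝ
  | [] => 1
  | (s, a) :: c => actionWeight τ c * τ (c, s) a

/-- The strategy enters the expectation only through the density `actionWeight` with respect to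
the expectation that counts every action with weight one. -/
theorem expect_eq_expect_one (M : POMDP Ω A S) (τ : Strategy S A) (n : ℕ)
    (ψ : List (S × A) → Ω → ℝ) :
    M.expect τ n ψ = M.expect (fun _ _ => 1) n fun c ω => actionWeight τ c * ψ c ω := by
  induction n generalizing ψ with
  | zero => simp [expect, actionWeight]
  | succ n ih =>
    rw [expect, ih, expect]
    congr 1
    funext c ω
    rw [Finset.mul_sum]
    refine Finset.sum_congr rfl fun a _ => ?_
    rw [one_mul, Finset.mul_sum, Finset.mul_sum]
    refine Finset.sum_congr rfl fun ω' _ => ?_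
    simp only [actionWeight]
    ring

end POMDP

/-- Run `σ` for `n` stages on a clock of which every stage is, independently with probability `q`,
effective. `simulate q σ n c s φ` is the expectation of `φ` of the past of `σ`, restricted to the
event that the effective stages form the past `c` and the current signal is `s`, every signal
being given weight one. -/
def simulate {S A : Type*} [Fintype A] (q : ℝ) (σ : Strategy S A) :
    ℕ → List (S × A) → S → (List (S × A) → ℝ) → ℝ
  | 0, [], _, φ => φ []
  | 0, _ :: _, _, _ => 0
  | n + 1, [], s, φ => (1 - q) * simulate q σ n [] s fun l => ∑ a, σ (l, s) a * φ ((s, a) :: l)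
  | n + 1, (t, b) :: c, s, φ =>
      (1 - q) * simulate q σ n ((t, b) :: c) s (fun l => ∑ a, σ (l, s) a * φ ((s, a) :: l)) +
        q * simulate q σ n c t fun l => σ (l, t) b * φ ((t, b) :: l)

section Simulate

variable {S A : Type*} [Fintype A] {q : ℝ} {σ : Strategy S A}

theorem simulate_add (n : ℕ) (c : List (S × A)) (s : S) (φ ψ : List (S × A) → ℝ) :
    simulate q σ n c s (fun l => φ l + ψ l) = simulate q σ n c s φ + simulate q σ n c s ψ := by
  induction n generalizing c s φ ψ with
  | zero => cases c <;> simp [simulate]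
  | succ n ih =>
    cases c with
    | nil => simp only [simulate, mul_add, Finset.sum_add_distrib, ih]
    | cons x c => simp only [simulate, mul_add, Finset.sum_add_distrib, ih]; ring

theorem simulate_mul_left (n : ℕ) (c : List (S × A)) (s : S) (r : ℝ) (φ : List (S × A) → ℝ) :
    simulate q σ n c s (fun l => r * φ l) = r * simulate q σ n c s φ := by
  induction n generalizing c s φ with
  | zero => cases c <;> simp [simulate]
  | succ n ih =>
    cases c with
    | nil => simp only [simulate, mul_left_comm _ r, ← Finset.mul_sum, ih]
    | cons x c => simp only [simulate, mul_left_comm _ r, ← Finset.mul_sum, ih]; ring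

theorem simulate_sum {ι : Type*} (I : Finset ι) (n : ℕ) (c : List (S × A)) (s : S)
    (φ : ι → List (S × A) → ℝ) :
    simulate q σ n c s (fun l => ∑ i ∈ I, φ i l) = ∑ i ∈ I, simulate q σ n c s (φ i) :=
  map_sum (AddMonoidHom.mk' (simulate q σ n c s) fun φ ψ => simulate_add n c s φ ψ) φ I ▸ by
    simp [Finset.sum_fn]

theorem simulate_nonneg (hq0 : 0 < q) (hq1 : q < 1) (hσ : IsStrategy σ) (n : ℕ)
    (c : List (S × A)) (s : S) {φ : List (S × A) → ℝ} (hφ : ∀ l, 0 ≤ φ l) :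
    0 ≤ simulate q σ n c s φ := by
  have hq : 0 ≤ 1 - q := by linarith
  induction n generalizing c s φ with
  | zero => cases c <;> simp [simulate, hφ]
  | succ n ih =>
    have h1 := fun c => ih c s (φ := fun l => ∑ a, σ (l, s) a * φ ((s, a) :: l))
      fun l => Finset.sum_nonneg fun a _ => mul_nonneg (hσ.1 _ _) (hφ _)
    cases c with
    | nil => exact mul_nonneg hq (h1 _)
    | cons x c =>
      exact add_nonneg (mul_nonneg hq (h1 _))
        (mul_nonneg hq0.le (ih c x.1 fun l => mul_nonneg (hσ.1 _ _) (hφ _)))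

/-- The joint weight of the past `c` of effective stages, and of `a` being the action of the next
effective stage. -/
noncomputable def effectiveWeight (q : ℝ) (σ : Strategy S A) (c : List (S × A)) (s : S) (a : A) :
    ℝ :=
  ∑' n, q * simulate q σ n c s fun l => σ (l, s) a

/-- The weight of the past `c` of effective stages. -/
noncomputable def pastWeight (q : ℝ) (σ : Strategy S A) : List (S × A) → ℝ
  | [] => 1
  | (s, a) :: c => effectiveWeight q σ c s a

theorem hasSum_simulate (hq0 : 0 < q) (hq1 : q < 1) (hσ : IsStrategy σ) (c : List (S × A)) :
    (∀ s, HasSum (fun n => q * simulate q σ n c s fun _ => 1) (pastWeight q σ c)) ∧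
      ∀ s a, HasSum (fun n => q * simulate q σ n c s fun l => σ (l, s) a)
        (effectiveWeight q σ c s a) := by
  have hle : ∀ η a, σ η a ≤ 1 := fun η a => by
    rw [← hσ.2 η]
    exact Finset.single_le_sum (f := σ η) (fun b _ => hσ.1 η b) (Finset.mem_univ a)
  have hnn := fun n c s => simulate_nonneg hq0 hq1 hσ n c s (φ := fun _ => 1) fun _ => zero_le_one
  have hnn' := fun n c s a => mul_nonneg hq0.le <|
    simulate_nonneg hq0 hq1 hσ n c s (φ := fun l => σ (l, s) a) fun _ => hσ.1 _ _
  have hstep : ∀ c, (∀ s, HasSum (fun n => q * simulate q σ n c s fun _ => 1) (pastWeight q σ c)) →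
      ∀ s a, HasSum (fun n => q * simulate q σ n c s fun l => σ (l, s) a)
        (effectiveWeight q σ c s a) := by
    intro c hc s a
    refine (Summable.of_nonneg_of_le (fun n => hnn' n c s a) (fun n => ?_)
      (hc s).summable).hasSum
    have := simulate_nonneg hq0 hq1 hσ n c s (φ := fun l => 1 + (-1) * σ (l, s) a)
      fun l => by linarith [hle (l, s) a]
    rw [simulate_add, simulate_mul_left] at this
    exact mul_le_mul_of_nonneg_left (by linarith) hq0.le
  have hone : ∀ c, ∀ s, HasSum (fun n => q * simulate q σ n c s fun _ => 1)
      (pastWeight q σ c) := by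
    intro c
    induction c with
    | nil =>
      intro s
      have := (hasSum_of_geometric_recursion (Y := 0) (y := fun _ => 0) hq0
        (fun n => hnn n [] s) (fun _ => le_rfl) hasSum_zero
        (fun n => by simp [simulate, hσ.2])).mul_left q
      simpa [simulate, pastWeight, hq0.ne'] using this
    | cons x c ih =>
      intro s
      have h := (hstep c ih x.1 x.2).mul_left (1 / q)
      have hy : (fun n => 1 / q * (q * simulate q σ n c x.1 fun l => σ (l, x.1) x.2))
          = fun n => simulate q σ n c x.1 fun l => σ (l, x.1) x.2 := by
        funext n; field_simp
      rw [hy] at h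
      have := (hasSum_of_geometric_recursion hq0 (fun n => hnn n (x :: c) s)
        (fun n => simulate_nonneg hq0 hq1 hσ n c x.1 fun _ => hσ.1 _ _) h
        (fun n => by simp [simulate, hσ.2])).mul_left q
      simpa [simulate, pastWeight, hq0.ne'] using this
  exact ⟨hone c, hstep c (hone c)⟩

theorem effectiveWeight_nonneg (hq0 : 0 < q) (hq1 : q < 1) (hσ : IsStrategy σ)
    (c : List (S × A)) (s : S) (a : A) : 0 ≤ effectiveWeight q σ c s a :=
  tsum_nonneg fun n => mul_nonneg hq0.le <| simulate_nonneg hq0 hq1 hσ n c s fun _ => hσ.1 _ _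

theorem sum_effectiveWeight (hq0 : 0 < q) (hq1 : q < 1) (hσ : IsStrategy σ)
    (c : List (S × A)) (s : S) : ∑ a, effectiveWeight q σ c s a = pastWeight q σ c := by
  have h := hasSum_sum fun a (_ : a ∈ Finset.univ) => (hasSum_simulate hq0 hq1 hσ c).2 s a
  simp only [← Finset.mul_sum, ← simulate_sum, hσ.2] at h
  exact h.unique ((hasSum_simulate hq0 hq1 hσ c).1 s)

open Classical in
/-- The behavior strategy that plays the actions of `σ` at effective stages. -/
noncomputable def mimic (q : ℝ) (σ : Strategy S A) : Strategy S A := fun η a =>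
  if pastWeight q σ η.1 = 0 then σ η a else effectiveWeight q σ η.1 η.2 a / pastWeight q σ η.1

theorem pastWeight_nonneg (hq0 : 0 < q) (hq1 : q < 1) (hσ : IsStrategy σ) (c : List (S × A)) :
    0 ≤ pastWeight q σ c := by
  cases c with
  | nil => exact zero_le_one
  | cons x c => exact effectiveWeight_nonneg hq0 hq1 hσ c x.1 x.2

theorem isStrategy_mimic (hq0 : 0 < q) (hq1 : q < 1) (hσ : IsStrategy σ) :
    IsStrategy (mimic q σ) := by
  refine ⟨fun η a => ?_, fun η => ?_⟩
  · unfold mimic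
    split_ifs
    · exact hσ.1 η a
    · exact div_nonneg (effectiveWeight_nonneg hq0 hq1 hσ _ _ _) (pastWeight_nonneg hq0 hq1 hσ _)
  · unfold mimic
    split_ifs with h
    · exact hσ.2 η
    · rw [← Finset.sum_div, sum_effectiveWeight hq0 hq1 hσ, div_self h]

theorem pastWeight_mul_mimic (hq0 : 0 < q) (hq1 : q < 1) (hσ : IsStrategy σ)
    (c : List (S × A)) (s : S) (a : A) :
    pastWeight q σ c * mimic q σ (c, s) a = effectiveWeight q σ c s a := by
  unfold mimic
  split_ifs with h
  · have h0 := sum_effectiveWeight hq0 hq1 hσ c s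
    rw [h, Finset.sum_eq_zero_iff_of_nonneg
      fun b _ => effectiveWeight_nonneg hq0 hq1 hσ c s b] at h0
    rw [h, zero_mul, h0 a (Finset.mem_univ a)]
  · exact mul_div_cancel₀ _ h

theorem actionWeight_mimic (hq0 : 0 < q) (hq1 : q < 1) (hσ : IsStrategy σ) (c : List (S × A)) :
    POMDP.actionWeight (mimic q σ) c = pastWeight q σ c := by
  induction c with
  | nil => rfl
  | cons x c ih =>
    rw [POMDP.actionWeight, ih, pastWeight_mul_mimic hq0 hq1 hσ, pastWeight]

end Simulate

namespace POMDP

variable {Ω A S : Type*} [Fintype Ω] [Fintype A]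

/-- The expectation of a function of the past of `σ` and the current state at stage `n + 1`,
restricted to the event that `k` of the first `n` stages are effective. -/
def jointE (M : POMDP Ω A S) (q : ℝ) (σ : Strategy S A) (n k : ℕ)
    (ψ : List (S × A) → Ω → ℝ) : ℝ :=
  M.expect (fun _ _ => 1) k fun c ω => simulate q σ n c (M.f ω) fun l => ψ l ω

variable (M : POMDP Ω A S) (q : ℝ) (σ : Strategy S A)

theorem jointE_zero_zero (ψ : List (S × A) → Ω → ℝ) :
    M.jointE q σ 0 0 ψ = ∑ ω, M.p1 ω * ψ [] ω := by
  simp [jointE, expect, simulate]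

theorem jointE_zero_succ (k : ℕ) (ψ : List (S × A) → Ω → ℝ) : M.jointE q σ 0 (k + 1) ψ = 0 := by
  simp [jointE, expect, simulate, expect_eq_sum_trajP]

theorem jointE_succ_zero (n : ℕ) (ψ : List (S × A) → Ω → ℝ) :
    M.jointE q σ (n + 1) 0 ψ = (1 - q) * M.jointE q σ n 0
      fun l ω => ∑ a, σ (l, M.f ω) a * ψ ((M.f ω, a) :: l) ω := by
  simp only [jointE, expect, simulate, Finset.mul_sum]
  exact Finset.sum_congr rfl fun _ _ => by ring

theorem jointE_succ_succ (n k : ℕ) (ψ : List (S × A) → Ω → ℝ) :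
    M.jointE q σ (n + 1) (k + 1) ψ = (1 - q) * M.jointE q σ n (k + 1)
        (fun l ω => ∑ a, σ (l, M.f ω) a * ψ ((M.f ω, a) :: l) ω) +
      q * M.jointE q σ n k
        fun l ω => ∑ a, σ (l, M.f ω) a * ∑ ω', M.P ω a ω' * ψ ((M.f ω, a) :: l) ω' := by
  simp only [jointE, expect]
  rw [← expect_mul_left, ← expect_mul_left, ← expect_add]
  congr 1
  funext c ω
  simp only [one_mul, simulate, Finset.mul_sum, simulate_sum, ← Finset.sum_add_distrib]
  refine Finset.sum_congr rfl fun a _ => Finset.sum_congr rfl fun ω' _ => ?_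
  simp only [mul_left_comm _ (M.P ω a ω'), simulate_mul_left, mul_add, Finset.mul_sum]

theorem abs_jointE_le (hM : M.IsValid) {q : ℝ} (hq0 : 0 < q) (hq1 : q < 1) {σ : Strategy S A}
    (hσ : IsStrategy σ) {C : ℝ} (n k : ℕ) {ψ : List (S × A) → Ω → ℝ}
    (hψ : ∀ l ω, |ψ l ω| ≤ C) : |M.jointE q σ n k ψ| ≤ C * binomWeight q n k := by
  have hq : 0 ≤ 1 - q := by linarith
  induction n generalizing k ψ with
  | zero =>
    cases k with
    | zero =>
      rw [jointE_zero_zero, binomWeight, mul_one]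
      exact abs_sum_mul_le hM.2.2.1 hM.2.2.2 fun ω => hψ [] ω
    | succ k => simp [jointE_zero_succ, binomWeight]
  | succ n ih =>
    have h1 := fun k => ih k (ψ := fun l ω => ∑ a, σ (l, M.f ω) a * ψ ((M.f ω, a) :: l) ω)
      fun l ω => abs_sum_mul_le (hσ.1 _) (hσ.2 _) fun a => hψ _ _
    cases k with
    | zero =>
      rw [jointE_succ_zero, binomWeight, abs_mul, abs_of_nonneg hq, mul_left_comm]
      exact mul_le_mul_of_nonneg_left (h1 0) hq
    | succ k =>
      have h2 := ih k
        (ψ := fun l ω => ∑ a, σ (l, M.f ω) a * ∑ ω', M.P ω a ω' * ψ ((M.f ω, a) :: l) ω')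
        fun l ω => abs_sum_mul_le (hσ.1 _) (hσ.2 _) fun a =>
          abs_sum_mul_le (hM.1 _ _) (hM.2.1 _ _) fun ω' => hψ _ _
      rw [jointE_succ_succ, binomWeight, mul_add, mul_left_comm C, mul_left_comm C]
      refine (abs_add_le _ _).trans ?_
      rw [abs_mul, abs_mul, abs_of_nonneg hq, abs_of_pos hq0]
      exact add_le_add (mul_le_mul_of_nonneg_left (h1 _) hq)
        (mul_le_mul_of_nonneg_left h2 hq0.le)

theorem jointE_add (n k : ℕ) (φ ψ : List (S × A) → Ω → ℝ) :
    M.jointE q σ n k (fun l ω => φ l ω + ψ l ω)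
      = M.jointE q σ n k φ + M.jointE q σ n k ψ := by
  simp only [jointE, simulate_add, expect_add]

theorem jointE_mul_left (n k : ℕ) (r : ℝ) (ψ : List (S × A) → Ω → ℝ) :
    M.jointE q σ n k (fun l ω => r * ψ l ω) = r * M.jointE q σ n k ψ := by
  simp only [jointE, simulate_mul_left, expect_mul_left]

theorem jointE_eq_zero (n k : ℕ) (h : n < k) (ψ : List (S × A) → Ω → ℝ) :
    M.jointE q σ n k ψ = 0 := by
  induction n generalizing k ψ with
  | zero => cases k with
    | zero => omega
    | succ k => exact M.jointE_zero_succ q σ k ψ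
  | succ n ih => cases k with
    | zero => omega
    | succ k =>
      rw [jointE_succ_succ, ih _ (by omega), ih _ (by omega)]
      ring

theorem expect_dur_eq_sum_jointE [DecidableEq Ω] (n : ℕ) (ψ : List (S × A) → Ω → ℝ) :
    (M.dur q).expect σ n ψ = ∑ k ∈ Finset.range (n + 1), M.jointE q σ n k ψ := by
  induction n generalizing ψ with
  | zero => simp [expect, jointE_zero_zero, dur]
  | succ n ih =>
    have hstep : (fun l ω => ∑ a, σ (l, (M.dur q).f ω) a *
          ∑ ω', (M.dur q).P ω a ω' * ψ (((M.dur q).f ω, a) :: l) ω')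
        = fun l ω => (1 - q) * (∑ a, σ (l, M.f ω) a * ψ ((M.f ω, a) :: l) ω) +
          q * ∑ a, σ (l, M.f ω) a * ∑ ω', M.P ω a ω' * ψ ((M.f ω, a) :: l) ω' := by
      funext l ω
      rw [Finset.mul_sum, Finset.mul_sum, ← Finset.sum_add_distrib]
      refine Finset.sum_congr rfl fun a _ => ?_
      simp only [dur, add_mul, Finset.sum_add_distrib, mul_assoc, ← Finset.mul_sum, ite_mul,
        one_mul, zero_mul, Finset.sum_ite_eq', Finset.mem_univ, if_true]
      ring
    rw [expect, hstep, ih]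
    conv_rhs => rw [Finset.sum_range_succ']
    simp only [jointE_add, jointE_mul_left, jointE_succ_succ, jointE_succ_zero,
      Finset.sum_add_distrib, ← Finset.mul_sum]
    have hshift := Finset.sum_range_succ' (fun k => M.jointE q σ n k
      fun l ω => ∑ a, σ (l, M.f ω) a * ψ ((M.f ω, a) :: l) ω) (n + 1)
    rw [Finset.sum_range_succ, M.jointE_eq_zero q σ n (n + 1) (by omega)] at hshift
    linear_combination (1 - q) * hshift

theorem hasSum_jointE_mimic {q : ℝ} (hq0 : 0 < q) (hq1 : q < 1) {σ : Strategy S A}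
    (hσ : IsStrategy σ) (k : ℕ) :
    HasSum (fun n => q * M.jointE q σ n k fun l ω => ∑ a, σ (l, M.f ω) a * M.g ω a)
      (M.stageE (mimic q σ) k) := by
  rw [stageE_eq_expect, expect_eq_expect_one]
  simp only [jointE, ← expect_mul_left]
  refine M.hasSum_expect _ k fun c ω => ?_
  simp only [simulate_sum, mul_comm _ (M.g ω _), simulate_mul_left, Finset.mul_sum,
    mul_left_comm _ (M.g ω _), actionWeight_mimic hq0 hq1 hσ, pastWeight_mul_mimic hq0 hq1 hσ]
  exact hasSum_sum fun a _ => ((hasSum_simulate hq0 hq1 hσ c).2 (M.f ω) a).mul_left _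

theorem R_dur_eq_R_mimic [DecidableEq Ω] (hM : M.IsValid) {q : ℝ} (hq0 : 0 < q) (hq1 : q < 1)
    {σ : Strategy S A} (hσ : IsStrategy σ) : (M.dur q).R σ = M.R (mimic q σ) := by
  refine liminf_average_eq_of_binomWeight hq0 hq1 (C := ∑ ω, ∑ a, |M.g ω a|)
    (X := fun n k => M.jointE q σ n k fun l ω => ∑ a, σ (l, M.f ω) a * M.g ω a)
    (fun n k => M.abs_jointE_le hM hq0 hq1 hσ n k fun l ω => ?_) (fun n => ?_)
    (M.hasSum_jointE_mimic hq0 hq1 hσ)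
  · refine abs_sum_mul_le (hσ.1 _) (hσ.2 _) fun a => ?_
    exact (Finset.single_le_sum (f := fun a => |M.g ω a|) (fun _ _ => abs_nonneg _)
      (Finset.mem_univ a)).trans (Finset.single_le_sum (f := fun ω => ∑ a, |M.g ω a|)
        (fun _ _ => Finset.sum_nonneg fun _ _ => abs_nonneg _) (Finset.mem_univ ω))
  · rw [stageE_eq_expect, ← expect_dur_eq_sum_jointE]
    rfl

end POMDP

/-- For `0 < h₁ < h₂ ≤ 1`, any strategy in `G_{h₁}` can be mimicked
by a strategy in `G_{h₂}` with the same expected long-run average payoff. -/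
theorem mimic_in_larger_duration {Ω A S : Type*} [Fintype Ω] [Fintype A] [DecidableEq Ω]
    (M : POMDP Ω A S) (hM : M.IsValid) (h₁ h₂ : ℝ)
    (h1pos : 0 < h₁) (h12 : h₁ < h₂) (h21 : h₂ ≤ 1)
    (σ : Strategy S A) (hσ : IsStrategy σ) :
    ∃ σ' : Strategy S A, IsStrategy σ' ∧ (M.dur h₁).R σ = (M.dur h₂).R σ' := by
  have h2pos : 0 < h₂ := h1pos.trans h12
  have hq0 : 0 < h₁ / h₂ := by positivity
  have hq1 : h₁ / h₂ < 1 := (div_lt_one h2pos).2 h12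
  refine ⟨mimic (h₁ / h₂) σ, isStrategy_mimic hq0 hq1 hσ, ?_⟩
  rw [← (M.dur h₂).R_dur_eq_R_mimic (hM.dur h2pos.le h21) hq0 hq1 hσ, POMDP.dur_dur,
    div_mul_cancel₀ _ h2pos.ne']
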